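/- arXiv:2110.04609 — 3 statements merged into one kernel-verified Lean document; each statement's English description precedes it below -/
import Mathlib

section
/- If f(x) = Σ_{n=0}^∞ aₙ exp(i bₙ x) where Σ|aₙ| < ∞, bₙ > 0 with bₙ → ∞, liminf_{n→∞} b_{n+1}/bₙ > 1, and aₙ bₙ does not tend to 0, then f is nowhere differentiable on ℝ. -/
open Filter

open MeasureTheory FourierTransform in
lemma lac_kernel (ε : ℝ) (hε : 0 < ε) : ∃ φ g : ℝ → ℂ, Continuous φ ∧ Integrable φ ∧
    Integrable (fun t => ‖t‖ * ‖φ t‖) ∧ g 1 = 1 ∧ (∀ s, ε ≤ |s - 1| → g s = 0) ∧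
    ∀ s : ℝ, ∫ t : ℝ, Complex.exp (Complex.I * ((s * (2 * Real.pi * t) : ℝ) : ℂ)) * φ t = g s := by
  let b : ContDiffBump (1 : ℝ) := ⟨ε / 2, ε, by positivity, by linarith⟩
  have h1 : HasCompactSupport (fun s : ℝ => ((b s : ℝ) : ℂ)) :=
    b.hasCompactSupport.comp_left (g := fun r : ℝ => (r : ℂ)) (by simp)
  have h2 : ContDiff ℝ (⊤ : ℕ∞) (fun s : ℝ => ((b s : ℝ) : ℂ)) :=
    Complex.ofRealCLM.contDiff.comp b.contDiff
  let g := h1.toSchwartzMap h2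
  have hg : ∀ s, g s = ((b s : ℝ) : ℂ) := fun s => rfl
  refine ⟨⇑(𝓕 g : SchwartzMap ℝ ℂ), g, (𝓕 g).continuous, (𝓕 g).integrable, ?_, ?_, ?_, ?_⟩
  · have h5 := SchwartzMap.integrable_pow_mul volume (𝓕 g : SchwartzMap ℝ ℂ) 1
    simp only [pow_one] at h5
    exact h5
  · rw [hg, b.one_of_mem_closedBall]
    · simp
    · exact Metric.mem_closedBall_self b.rIn_pos.le
  · intro s hs
    rw [hg, b.zero_of_le_dist]
    · simp
    · rw [Real.dist_eq]; exact hs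
  · intro s
    have h3 : 𝓕⁻ (𝓕 g) = g := FourierTransform.fourierInv_fourier_eq g
    have h4 : (𝓕⁻ (𝓕 g)) s = g s := by rw [h3]
    rw [← h4, SchwartzMap.fourierInv_coe, Real.fourierInv_eq']
    congr 1
    ext t
    simp only [smul_eq_mul]
    congr 2
    simp
    ring

lemma lac_sep (B : ℕ → ℝ) (hBpos : ∀ n, 0 < B n)
    (hBtop : Tendsto B atTop atTop)
    (hlac : 1 < Filter.liminf (fun n => B (n + 1) / B n) atTop) :
    ∃ ε : ℝ, 0 < ε ∧ ε < 1 ∧ ∀ᶠ n in atTop, ∀ m, m ≠ n → ε ≤ |B m / B n - 1| := by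
  obtain ⟨q, hq1, hq⟩ := exists_between hlac
  have hev := eventually_lt_of_lt_liminf hq
    ⟨0, by simp only [eventually_map]; exact Eventually.of_forall fun n => (div_pos (hBpos _) (hBpos _)).le⟩
  obtain ⟨N, hN⟩ := eventually_atTop.1 hev
  have hq0 : 0 < q := by linarith
  have hstep : ∀ n, N ≤ n → q * B n ≤ B (n + 1) := by
    intro n hn
    have := hN n hn
    rw [lt_div_iff₀ (hBpos n)] at this
    exact this.le
  have hup : ∀ n, N ≤ n → ∀ m, n + 1 ≤ m → q * B n ≤ B m := by
    intro n hn m hm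
    induction m, hm using Nat.le_induction with
    | base => exact hstep n hn
    | succ k hk ih =>
      have h := hstep k (by omega)
      have := hBpos k
      nlinarith
  have hsmall : ∀ᶠ n in atTop, ∀ m ∈ Finset.range N, q * B m ≤ B n := by
    rw [Filter.eventually_all_finset]
    intro m _
    exact hBtop.eventually_ge_atTop _
  have hinv : q⁻¹ < 1 := inv_lt_one_of_one_lt₀ hq1
  have hinv0 : 0 < q⁻¹ := by positivity
  refine ⟨1 - q⁻¹, by linarith, by linarith, ?_⟩
  filter_upwards [hsmall, eventually_ge_atTop N] with n hs hn m hmn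
  have hBn := hBpos n
  have key : q * B m ≤ B n → 1 - q⁻¹ ≤ |B m / B n - 1| := by
    intro h
    have : B m / B n ≤ q⁻¹ := by
      rw [div_le_iff₀ hBn, inv_mul_eq_div, le_div_iff₀ hq0]; linarith
    rw [abs_sub_comm]
    exact le_trans (by linarith) (le_abs_self _)
  rcases lt_or_gt_of_ne hmn with h | h
  · apply key
    by_cases hmN : m < N
    · exact hs m (Finset.mem_range.2 hmN)
    · exact hup m (by omega) n h
  · have h2 := hup n hn m h
    have : q ≤ B m / B n := by rw [le_div_iff₀ hBn]; exact h2
    have h3 : q * q⁻¹ = 1 := mul_inv_cancel₀ hq0.ne'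
    refine le_trans ?_ (le_abs_self _)
    nlinarith [sq_nonneg (1 - q⁻¹)]

open MeasureTheory in
lemma lac_limit (F φ : ℝ → ℂ) (B : ℕ → ℝ) (hBpos : ∀ n, 0 < B n)
    (hBtop : Tendsto B atTop atTop) (hF : Continuous F) (M : ℝ) (hM : ∀ h, ‖F h‖ ≤ M)
    (h0 : F 0 = 0) (hd : HasDerivAt F 0 0) (hφ : Continuous φ)
    (hφi : Integrable (fun t => ‖t‖ * ‖φ t‖)) :
    Tendsto (fun n => ∫ t : ℝ, (B n : ℂ) * (F (2 * Real.pi * t / B n) * φ t)) atTop (nhds 0) := by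
  have ho : ∀ c > 0, ∀ᶠ h in nhds (0:ℝ), ‖F h‖ ≤ c * ‖h‖ := by
    intro c hc
    have := (hasDerivAt_iff_isLittleO_nhds_zero.1 hd).def hc
    simpa [h0] using this
  obtain ⟨C, hC0, hC⟩ : ∃ C, 0 ≤ C ∧ ∀ h, ‖F h‖ ≤ C * |h| := by
    obtain ⟨δ, hδ, hb⟩ := Metric.eventually_nhds_iff.1 (ho 1 one_pos)
    have hM0 : 0 ≤ M := (norm_nonneg _).trans (hM 0)
    refine ⟨1 + M / δ, by positivity, fun h => ?_⟩
    by_cases hh : |h| < δ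
    · have := hb (y := h) (by simpa [Real.dist_eq] using hh)
      rw [Real.norm_eq_abs] at this
      have : 0 ≤ M / δ * |h| := by positivity
      nlinarith
    · push Not at hh
      have h1 : M ≤ M / δ * |h| := by
        rw [div_mul_eq_mul_div, le_div_iff₀ hδ]; gcongr
      have := hM h
      have := abs_nonneg h
      nlinarith
  rw [show (0:ℂ) = ∫ t : ℝ, (0:ℂ) by simp]
  apply tendsto_integral_filter_of_dominated_convergence
    (fun t => C * (2 * Real.pi) * (‖t‖ * ‖φ t‖))
  · refine Eventually.of_forall fun n => Continuous.aestronglyMeasurable ?_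
    fun_prop
  · refine Eventually.of_forall fun n => Eventually.of_forall fun t => ?_
    have hB := hBpos n
    have := hC (2 * Real.pi * t / B n)
    rw [norm_mul, norm_mul, Complex.norm_real, Real.norm_of_nonneg hB.le]
    calc B n * (‖F (2 * Real.pi * t / B n)‖ * ‖φ t‖)
        ≤ B n * ((C * |2 * Real.pi * t / B n|) * ‖φ t‖) := by gcongr
      _ = C * (2 * Real.pi) * (‖t‖ * ‖φ t‖) := by
        rw [abs_div, abs_mul, abs_of_pos hB, abs_of_pos Real.two_pi_pos, Real.norm_eq_abs]
        field_simp
  · exact hφi.const_mul _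
  · refine Eventually.of_forall fun t => ?_
    rw [Metric.tendsto_nhds]
    intro e he
    have hpi := Real.pi_pos
    have hK : 0 < 2 * Real.pi * |t| * ‖φ t‖ + 1 := by positivity
    have hlim : Tendsto (fun n => 2 * Real.pi * t / B n) atTop (nhds 0) :=
      hBtop.const_div_atTop _
    filter_upwards [hlim.eventually (ho (e / (2 * Real.pi * |t| * ‖φ t‖ + 1)) (by positivity))] with n hn
    have hB := hBpos n
    rw [dist_zero_right, norm_mul, norm_mul, Complex.norm_real, Real.norm_of_nonneg hB.le]
    calc B n * (‖F (2 * Real.pi * t / B n)‖ * ‖φ t‖)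
        ≤ B n * ((e / (2 * Real.pi * |t| * ‖φ t‖ + 1) * ‖2 * Real.pi * t / B n‖) * ‖φ t‖) := by gcongr
      _ = e * ((2 * Real.pi * |t| * ‖φ t‖) / (2 * Real.pi * |t| * ‖φ t‖ + 1)) := by
        rw [Real.norm_eq_abs, abs_div, abs_mul, abs_of_pos hB, abs_of_pos Real.two_pi_pos]
        field_simp
      _ < e * 1 := by
        gcongr
        rw [div_lt_one hK]; linarith
      _ = e := mul_one e

open MeasureTheory in
/-- A lacunary series `f(x) = ∑ aₙ exp(i bₙ x)` with `∑‖aₙ‖ < ∞`,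
`bₙ > 0`, `bₙ → ∞`, `liminf b_{n+1}/bₙ > 1` and `aₙ bₙ` not tending to `0`
is nowhere differentiable on ℝ. -/
theorem lacunary_nowhere_differentiable (A : ℕ → ℂ) (B : ℕ → ℝ)
    (hA : Summable fun n => ‖A n‖)
    (hBpos : ∀ n, 0 < B n)
    (hBtop : Tendsto B atTop atTop)
    (hlac : 1 < Filter.liminf (fun n => B (n + 1) / B n) atTop)
    (hnz : ¬ Tendsto (fun n => A n * (B n : ℂ)) atTop (nhds 0)) :
    ∀ x : ℝ, ¬ DifferentiableAt ℝ
      (fun t : ℝ => ∑' n : ℕ, A n * Complex.exp (Complex.I * (B n : ℂ) * (t : ℂ))) x := by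
  intro x hdiff
  apply hnz
  obtain ⟨ε, hε0, hε1, hsep⟩ := lac_sep B hBpos hBtop hlac
  obtain ⟨φ, g, hφc, hφi, hφi1, hg1, hg0, hφg⟩ := lac_kernel ε hε0
  set f : ℝ → ℂ := fun t : ℝ => ∑' n : ℕ, A n * Complex.exp (Complex.I * (B n : ℂ) * (t : ℂ)) with hf
  have hexp : ∀ y : ℝ, ‖Complex.exp (Complex.I * (y : ℂ))‖ = 1 := fun y => by
    rw [mul_comm]; exact Complex.norm_exp_ofReal_mul_I y
  have hnt : ∀ n (t : ℝ), ‖A n * Complex.exp (Complex.I * (B n : ℂ) * (t : ℂ))‖ = ‖A n‖ := by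
    intro n t
    have := hexp (B n * t)
    push_cast at this
    rw [norm_mul, mul_assoc, this, mul_one]
  have hfc : Continuous f :=
    continuous_tsum (fun n => by fun_prop) hA (fun n t => (hnt n t).le)
  have hfb : ∀ t, ‖f t‖ ≤ ∑' n, ‖A n‖ := fun t =>
    tsum_of_norm_bounded hA.hasSum (fun n => (hnt n t).le)
  set c := deriv f x with hc
  let F : ℝ → ℂ := fun h => f (x + h) - f x - c * ((Complex.exp (Complex.I * (h : ℂ)) - 1) / Complex.I)
  have hFc : Continuous F := by fun_prop
  have hF0 : F 0 = 0 := by simp [F]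
  have hFb : ∀ h, ‖F h‖ ≤ (∑' n, ‖A n‖) + (∑' n, ‖A n‖) + ‖c‖ * 2 := by
    intro h
    refine (norm_sub_le _ _).trans (add_le_add ((norm_sub_le _ _).trans
      (add_le_add (hfb _) (hfb _))) ?_)
    rw [norm_mul, norm_div, Complex.norm_I, div_one]
    gcongr
    refine (norm_sub_le _ _).trans ?_
    rw [hexp]; norm_num
  have hFd : HasDerivAt F 0 0 := by
    have h1 : HasDerivAt (fun h : ℝ => f (x + h)) c 0 := by
      have := hdiff.hasDerivAt
      rw [← add_zero x] at this
      have h2 := this.comp_const_add x 0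
      simpa using h2
    have h3 : HasDerivAt (fun h : ℝ => Complex.exp (Complex.I * (h : ℂ))) Complex.I 0 := by
      have h4 := ((Complex.ofRealCLM.hasDerivAt (x := (0:ℝ))).const_mul Complex.I).cexp
      simpa using h4
    have h5 := (h1.sub_const (f x)).sub (((h3.sub_const 1).div_const Complex.I).const_mul c)
    have h6 : c - c * (Complex.I / Complex.I) = 0 := by
      rw [div_self Complex.I_ne_zero, mul_one, sub_self]
    rw [h6] at h5
    exact h5
  have hL := lac_limit F φ B hBpos hBtop hFc _ hFb hF0 hFd hφc hφi1
  -- the main identity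
  have hphi_bdd : ∀ s : ℝ, Integrable (fun t : ℝ =>
      Complex.exp (Complex.I * ((s * (2 * Real.pi * t) : ℝ) : ℂ)) * φ t) := by
    intro s
    refine hφi.mono (Continuous.aestronglyMeasurable (by fun_prop)) (Eventually.of_forall fun t => ?_)
    rw [norm_mul, hexp, one_mul]
  have hg00 : g 0 = 0 := hg0 0 (by simpa using hε1.le)
  have hint0 : ∫ t, φ t = 0 := by
    have := hφg 0
    rw [hg00] at this
    simpa using this
  have hid : ∀ᶠ n in atTop, ∫ t : ℝ, (B n : ℂ) * (F (2 * Real.pi * t / B n) * φ t) =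
      B n * (A n * Complex.exp (Complex.I * ((B n * x : ℝ) : ℂ))) := by
    have hinv : ∀ᶠ n in atTop, (B n)⁻¹ ≤ 1 - ε :=
      (tendsto_inv_atTop_zero.comp hBtop).eventually_le_const (by linarith)
    filter_upwards [hsep, hinv] with n hn hn1
    have hB := hBpos n
    rw [integral_const_mul]
    congr 1
    have hterm : ∀ m, ∫ t : ℝ, A m * Complex.exp (Complex.I * (B m : ℂ) * ((x + 2 * Real.pi * t / B n : ℝ) : ℂ)) * φ t
        = A m * Complex.exp (Complex.I * ((B m * x : ℝ) : ℂ)) * g (B m / B n) := by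
      intro m
      rw [← hφg, ← integral_const_mul]
      congr 1
      ext t
      have e0 : Complex.I * (B m : ℂ) * ((x + 2 * Real.pi * t / B n : ℝ) : ℂ) =
          Complex.I * ((B m * x : ℝ) : ℂ) +
            Complex.I * ((B m / B n * (2 * Real.pi * t) : ℝ) : ℂ) := by
        push_cast
        ring
      rw [e0, Complex.exp_add]
      ring
    have hsum : HasSum (fun m => ∫ t : ℝ, A m * Complex.exp (Complex.I * (B m : ℂ) * ((x + 2 * Real.pi * t / B n : ℝ) : ℂ)) * φ t)
        (∫ t : ℝ, ∑' m, A m * Complex.exp (Complex.I * (B m : ℂ) * ((x + 2 * Real.pi * t / B n : ℝ) : ℂ)) * φ t) := by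
      apply hasSum_integral_of_summable_integral_norm
      · intro m
        refine (hφi.const_mul (A m)).mono (Continuous.aestronglyMeasurable (by fun_prop)) (Eventually.of_forall fun t => ?_)
        rw [norm_mul, hnt, norm_mul]
      · simp only [norm_mul _ (φ _), hnt, integral_const_mul]
        exact hA.mul_right _
    have hfint : ∫ t : ℝ, f (x + 2 * Real.pi * t / B n) * φ t
        = A n * Complex.exp (Complex.I * ((B n * x : ℝ) : ℂ)) := by
      have e1 : ∀ t : ℝ, f (x + 2 * Real.pi * t / B n) * φ t = ∑' m, A m * Complex.exp (Complex.I * (B m : ℂ) * ((x + 2 * Real.pi * t / B n : ℝ) : ℂ)) * φ t :=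
        fun t => tsum_mul_right.symm
      simp_rw [e1]
      rw [← hsum.tsum_eq]
      simp_rw [hterm]
      rw [tsum_eq_single n]
      · rw [div_self hB.ne', hg1, mul_one]
      · intro m hm
        rw [hg0 _ (hn m hm), mul_zero]
    have hfi : Integrable (fun t : ℝ => f (x + 2 * Real.pi * t / B n) * φ t) := by
      refine (hφi.const_mul ((∑' n, ‖A n‖ : ℝ) : ℂ)).mono (Continuous.aestronglyMeasurable (by fun_prop)) (Eventually.of_forall fun t => ?_)
      rw [norm_mul, norm_mul, Complex.norm_real]
      gcongr
      exact (hfb _).trans (le_abs_self _)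
    have hgz : g (B n)⁻¹ = 0 := by
      apply hg0
      rw [abs_sub_comm]
      exact le_trans (by linarith) (le_abs_self _)
    have e2 : ∀ t : ℝ, F (2 * Real.pi * t / B n) * φ t = f (x + 2 * Real.pi * t / B n) * φ t
        - (f x - c / Complex.I) * φ t
        - c / Complex.I * (Complex.exp (Complex.I * (((B n)⁻¹ * (2 * Real.pi * t) : ℝ) : ℂ)) * φ t) := by
      intro t
      have : (B n)⁻¹ * (2 * Real.pi * t) = 2 * Real.pi * t / B n := by ring
      rw [this]
      simp only [F]
      ring
    simp_rw [e2]
    rw [integral_sub, integral_sub, integral_const_mul, integral_const_mul, hφg, hgz, hint0, hfint]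
    · simp
    · exact hfi
    · exact hφi.const_mul _
    · exact hfi.sub (hφi.const_mul _)
    · exact (hphi_bdd _).const_mul _
  have hL2 := hL.congr' hid
  rw [tendsto_zero_iff_norm_tendsto_zero] at hL2 ⊢
  refine hL2.congr fun n => ?_
  rw [norm_mul, norm_mul, norm_mul, hexp, mul_one, mul_comm]
end

section
/- If f(x) = Σ_{n=0}^∞ aₙ exp(i bₙ x) with Σ|aₙ| < ∞, bₙ > 0 increasing to infinity, liminf b_{n+1}/bₙ > 1, and sup_n |aₙ| bₙ = ∞, then f is not Lipschitz continuous at any point of ℝ. -/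
open Filter

open FourierTransform SchwartzMap MeasureTheory in
/-- A test kernel whose (inverse) Fourier transform is a bump around 1. -/
lemma exists_kernel (ε : ℝ) (hε : 0 < ε) (hε1 : ε ≤ 1) :
    ∃ φ : ℝ → ℂ, Continuous φ ∧ Integrable φ ∧ Integrable (fun x => |x| * ‖φ x‖) ∧
      (∫ x : ℝ, Complex.exp (Complex.I * ((2 * Real.pi * x : ℝ) : ℂ)) * φ x = 1) ∧
      (∀ ξ : ℝ, ε ≤ |ξ - 1| →
        ∫ x : ℝ, Complex.exp (Complex.I * ((2 * Real.pi * x * ξ : ℝ) : ℂ)) * φ x = 0) := by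
  let b : ContDiffBump (1 : ℝ) := ⟨ε / 2, ε, by linarith, by linarith⟩
  have hc : HasCompactSupport (fun x : ℝ => ((b x : ℝ) : ℂ)) :=
    b.hasCompactSupport.comp_left (g := fun y : ℝ => (y : ℂ)) (by simp)
  have hs : ContDiff ℝ (⊤ : ℕ∞) (fun x : ℝ => ((b x : ℝ) : ℂ)) :=
    Complex.ofRealCLM.contDiff.comp b.contDiff
  let ψ : 𝓢(ℝ, ℂ) := hc.toSchwartzMap hs
  have hψ : ∀ x, ψ x = ((b x : ℝ) : ℂ) := fun x => rfl
  have key : ∀ ξ : ℝ,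
      ∫ x : ℝ, Complex.exp (Complex.I * ((2 * Real.pi * x * ξ : ℝ) : ℂ)) * (𝓕 ψ) x = ψ ξ := by
    intro ξ
    have h1 : 𝓕⁻ (𝓕 ψ) = ψ := FourierTransform.fourierInv_fourier_eq ψ
    have h2 : (𝓕⁻ (𝓕 ψ)) ξ = ψ ξ := by rw [h1]
    rw [SchwartzMap.fourierInv_coe, Real.fourierInv_eq'] at h2
    rw [← h2]
    congr 1
    ext x
    simp only [smul_eq_mul]
    congr 2
    simp
    ring
  refine ⟨((𝓕 ψ : 𝓢(ℝ, ℂ)) : ℝ → ℂ), (𝓕 ψ).continuous, (𝓕 ψ).integrable, ?_, ?_, ?_⟩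
  · have h := (𝓕 ψ).integrable_pow_mul volume 1
    simp only [pow_one, Real.norm_eq_abs] at h
    exact h
  · have := key 1
    simp only [mul_one] at this
    rw [this, hψ, b.one_of_mem_closedBall (by simp [b.rIn_pos.le])]
    simp
  · intro ξ hξ
    rw [key, hψ, b.zero_of_le_dist (by rw [Real.dist_eq]; exact hξ)]
    simp

lemma exists_ratio (B : ℕ → ℝ)
    (hlac : 1 < Filter.liminf (fun n => B (n + 1) / B n) atTop) :
    ∃ q : ℝ, 1 < q ∧ ∃ N, ∀ n ≥ N, q ≤ B (n + 1) / B n := by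
  rw [Filter.liminf_eq] at hlac
  have hne : {a : ℝ | ∀ᶠ n in atTop, a ≤ B (n + 1) / B n}.Nonempty := by
    by_contra h
    rw [Set.not_nonempty_iff_eq_empty] at h
    rw [h, Real.sSup_empty] at hlac
    linarith
  obtain ⟨q, hq, hq1⟩ := exists_lt_of_lt_csSup hne hlac
  exact ⟨q, hq1, eventually_atTop.1 hq⟩

lemma exists_sep (B : ℕ → ℝ) (hBpos : ∀ n, 0 < B n) (hBmono : StrictMono B)
    (hlac : 1 < Filter.liminf (fun n => B (n + 1) / B n) atTop) :
    ∃ ε : ℝ, 0 < ε ∧ ε ≤ 1 ∧ ∃ N, ∀ n ≥ N, ∀ k, k ≠ n → ε ≤ |B k / B n - 1| := by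
  obtain ⟨q, hq, N, hN⟩ := exists_ratio B hlac
  have hq0 : 0 < q := by linarith
  have hi : q * q⁻¹ = 1 := mul_inv_cancel₀ hq0.ne'
  have hi0 : 0 < q⁻¹ := inv_pos.2 hq0
  have hi1 : q⁻¹ < 1 := inv_lt_one_of_one_lt₀ hq
  refine ⟨1 - q⁻¹, by linarith, by linarith, N + 1, ?_⟩
  intro n hn k hk
  have hBn := hBpos n
  rcases lt_or_gt_of_ne hk with h | h
  · obtain ⟨m, rfl⟩ : ∃ m, n = m + 1 := ⟨n - 1, by omega⟩
    have h1 := hN m (by omega)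
    have h2 : B k ≤ B m := hBmono.monotone (by omega)
    rw [le_div_iff₀ (hBpos m)] at h1
    have h3 : B k / B (m + 1) ≤ q⁻¹ := by
      rw [div_le_iff₀ hBn, inv_mul_eq_div, le_div_iff₀ hq0]
      nlinarith
    rw [abs_sub_comm]
    exact le_trans (by linarith) (le_abs_self _)
  · have h1 := hN n (by omega)
    have h2 : B (n + 1) ≤ B k := hBmono.monotone (by omega)
    have h3 : q ≤ B k / B n := h1.trans (by gcongr)
    refine le_trans ?_ (le_abs_self _)
    nlinarith

lemma norm_exp_I_mul (y : ℝ) : ‖Complex.exp (Complex.I * (y : ℂ))‖ = 1 := by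
  rw [mul_comm]; exact Complex.norm_exp_ofReal_mul_I y

open MeasureTheory in
/-- The main estimate, for a series recentred at the point. -/
lemma main_bound (a : ℕ → ℂ) (B : ℕ → ℝ) (ha : Summable fun n => ‖a n‖)
    (hBpos : ∀ n, 0 < B n) (C : ℝ)
    (hC : ∀ y : ℝ, ‖∑' k, a k * (Complex.exp (Complex.I * ((B k * y : ℝ) : ℂ)) - 1)‖ ≤ C * |y|)
    (ε : ℝ) (hε1 : ε ≤ 1) (φ : ℝ → ℂ) (hφc : Continuous φ) (hφ : Integrable φ)
    (hφ' : Integrable (fun x => |x| * ‖φ x‖))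
    (h1 : ∫ x : ℝ, Complex.exp (Complex.I * ((2 * Real.pi * x : ℝ) : ℂ)) * φ x = 1)
    (h0 : ∀ ξ : ℝ, ε ≤ |ξ - 1| →
        ∫ x : ℝ, Complex.exp (Complex.I * ((2 * Real.pi * x * ξ : ℝ) : ℂ)) * φ x = 0)
    (n : ℕ) (hn : ∀ k, k ≠ n → ε ≤ |B k / B n - 1|) :
    ‖a n‖ * B n ≤ C * (2 * Real.pi) * ∫ x : ℝ, |x| * ‖φ x‖ := by
  have hBn := hBpos n
  let F : ℕ → ℝ → ℂ := fun k x =>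
    a k * (Complex.exp (Complex.I * ((B k * (2 * Real.pi * x / B n) : ℝ) : ℂ)) - 1) * φ x
  have hEint : ∀ ξ : ℝ, Integrable
      (fun x : ℝ => Complex.exp (Complex.I * ((2 * Real.pi * x * ξ : ℝ) : ℂ)) * φ x) := by
    intro ξ
    refine hφ.mono (by fun_prop) (Eventually.of_forall fun x => ?_)
    rw [norm_mul, norm_exp_I_mul, one_mul]
  have hFeq : ∀ k, F k = fun x => a k *
      (Complex.exp (Complex.I * ((2 * Real.pi * x * (B k / B n) : ℝ) : ℂ)) * φ x - φ x) := by
    intro k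
    ext x
    simp only [F]
    have : B k * (2 * Real.pi * x / B n) = 2 * Real.pi * x * (B k / B n) := by ring
    rw [this]
    ring
  have hFint : ∀ k, Integrable (F k) := by
    intro k
    rw [hFeq]
    exact ((hEint _).sub hφ).const_mul _
  have hφ0 : ∫ x, φ x = 0 := by
    have := h0 0 (by simpa using hε1)
    simpa using this
  have hFval : ∀ k, ∫ x, F k x = if k = n then a n else 0 := by
    intro k
    rw [hFeq, integral_const_mul, integral_sub (hEint _) hφ, hφ0, sub_zero]
    split_ifs with h
    · subst h
      rw [div_self hBn.ne']
      simp only [mul_one]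
      rw [h1, mul_one]
    · rw [h0 _ (hn k h), mul_zero]
  have hFb : ∀ k x, ‖F k x‖ ≤ 2 * ‖a k‖ * ‖φ x‖ := by
    intro k x
    simp only [F, norm_mul]
    rw [mul_comm 2 ‖a k‖]
    gcongr
    have : ‖Complex.exp (Complex.I * ((B k * (2 * Real.pi * x / B n) : ℝ) : ℂ)) - 1‖ ≤ 2 := by
      refine (norm_sub_le _ _).trans ?_
      rw [norm_exp_I_mul]; norm_num
    exact this
  have hsum : Summable fun k => ∫ x, ‖F k x‖ := by
    refine Summable.of_nonneg_of_le (fun k => integral_nonneg fun x => norm_nonneg _)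
      (fun k => ?_) ((ha.mul_left 2).mul_right (∫ x, ‖φ x‖))
    rw [← integral_const_mul]
    exact integral_mono (hFint k).norm (hφ.norm.const_mul _) (hFb k)
  have hI := integral_tsum_of_summable_integral_norm hFint hsum
  rw [tsum_congr hFval, tsum_ite_eq] at hI
  have hle : ‖∫ x, ∑' k, F k x‖ ≤ ∫ x, (C * (2 * Real.pi) / B n) * (|x| * ‖φ x‖) := by
    refine norm_integral_le_of_norm_le (hφ'.const_mul _) (Eventually.of_forall fun x => ?_)
    simp only [F]
    rw [tsum_mul_right, norm_mul]
    have := hC (2 * Real.pi * x / B n)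
    rw [abs_div, abs_mul, abs_of_pos hBn, abs_of_pos Real.two_pi_pos] at this
    calc _ ≤ C * (2 * Real.pi * |x| / B n) * ‖φ x‖ := by gcongr
      _ = _ := by ring
  rw [← hI, integral_const_mul] at hle
  calc _ ≤ (C * (2 * Real.pi) / B n * ∫ x : ℝ, |x| * ‖φ x‖) * B n := by gcongr
    _ = _ := by field_simp

/-- A lacunary series `f(x) = ∑ aₙ exp(i bₙ x)` with `∑‖aₙ‖ < ∞`,
`bₙ > 0` increasing to infinity, `liminf b_{n+1}/bₙ > 1` and `sup_n ‖aₙ‖ bₙ = ∞`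
is not Lipschitz continuous at any point of ℝ. -/
theorem lacunary_not_lipschitz_at_any_point (A : ℕ → ℂ) (B : ℕ → ℝ)
    (hA : Summable fun n => ‖A n‖)
    (hBpos : ∀ n, 0 < B n)
    (hBmono : StrictMono B)
    (hBtop : Tendsto B atTop atTop)
    (hlac : 1 < Filter.liminf (fun n => B (n + 1) / B n) atTop)
    (hsup : ¬ BddAbove (Set.range fun n => ‖A n‖ * B n)) :
    ∀ x₀ : ℝ, ¬ ∃ L δ : ℝ, 0 < L ∧ 0 < δ ∧ ∀ x : ℝ, |x - x₀| < δ →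
      ‖(∑' n : ℕ, A n * Complex.exp (Complex.I * (B n : ℂ) * (x : ℂ)))
        - ∑' n : ℕ, A n * Complex.exp (Complex.I * (B n : ℂ) * (x₀ : ℂ))‖
          ≤ L * |x - x₀| := by
  rintro x₀ ⟨L, δ, hL, hδ, hLip⟩
  apply hsup
  obtain ⟨ε, hε, hε1, N, hN⟩ := exists_sep B hBpos hBmono hlac
  obtain ⟨φ, hφc, hφ, hφ', h1, h0⟩ := exists_kernel ε hε hε1
  let a : ℕ → ℂ := fun k => A k * Complex.exp (Complex.I * ((B k * x₀ : ℝ) : ℂ))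
  have hna : ∀ k, ‖a k‖ = ‖A k‖ := fun k => by
    simp only [a, norm_mul, norm_exp_I_mul, mul_one]
  have ha : Summable fun k => ‖a k‖ := by simpa only [hna] using hA
  have hs : ∀ x : ℝ, Summable fun n : ℕ =>
      A n * Complex.exp (Complex.I * (B n : ℂ) * (x : ℂ)) := by
    intro x
    refine Summable.of_norm ?_
    refine hA.congr fun n => ?_
    have : Complex.I * (B n : ℂ) * (x : ℂ) = Complex.I * ((B n * x : ℝ) : ℂ) := by
      push_cast; ring
    rw [this, norm_mul, norm_exp_I_mul, mul_one]
  have hdiff : ∀ y : ℝ, ∑' k, a k * (Complex.exp (Complex.I * ((B k * y : ℝ) : ℂ)) - 1) =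
      (∑' n : ℕ, A n * Complex.exp (Complex.I * (B n : ℂ) * ((x₀ + y : ℝ) : ℂ)))
        - ∑' n : ℕ, A n * Complex.exp (Complex.I * (B n : ℂ) * (x₀ : ℂ)) := by
    intro y
    rw [← (hs _).tsum_sub (hs _)]
    refine tsum_congr fun k => ?_
    have e1 : Complex.I * (B k : ℂ) * ((x₀ + y : ℝ) : ℂ) =
      Complex.I * ((B k * x₀ : ℝ) : ℂ) + Complex.I * ((B k * y : ℝ) : ℂ) := by
      push_cast; ring
    have e2 : Complex.I * (B k : ℂ) * (x₀ : ℂ) = Complex.I * ((B k * x₀ : ℝ) : ℂ) := by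
      push_cast; ring
    rw [e1, e2, Complex.exp_add]
    simp only [a]
    ring
  let S : ℝ := ∑' k, ‖A k‖
  have hS : 0 ≤ S := tsum_nonneg fun k => norm_nonneg _
  have hC : ∀ y : ℝ, ‖∑' k, a k * (Complex.exp (Complex.I * ((B k * y : ℝ) : ℂ)) - 1)‖
      ≤ (L + 2 * S / δ) * |y| := by
    intro y
    have hq : 0 ≤ 2 * S / δ := by positivity
    rcases lt_or_ge |y| δ with h | h
    · rw [hdiff]
      have := hLip (x₀ + y) (by simpa using h)
      rw [add_sub_cancel_left] at this
      nlinarith [abs_nonneg y]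
    · have hb : ‖∑' k, a k * (Complex.exp (Complex.I * ((B k * y : ℝ) : ℂ)) - 1)‖ ≤ 2 * S := by
        refine tsum_of_norm_bounded (hA.hasSum.mul_left 2) fun k => ?_
        rw [norm_mul, hna]
        have : ‖Complex.exp (Complex.I * ((B k * y : ℝ) : ℂ)) - 1‖ ≤ 2 := by
          refine (norm_sub_le _ _).trans ?_
          rw [norm_exp_I_mul]; norm_num
        nlinarith [norm_nonneg (A k)]
      have h3 : 2 * S = 2 * S / δ * δ := by field_simp
      nlinarith [mul_le_mul_of_nonneg_left h hq, mul_nonneg hL.le (abs_nonneg y)]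
  refine Filter.IsBoundedUnder.bddAbove_range
    ⟨(L + 2 * S / δ) * (2 * Real.pi) * ∫ x : ℝ, |x| * ‖φ x‖, ?_⟩
  rw [Filter.eventually_map]
  refine eventually_atTop.2 ⟨N, fun n hn => ?_⟩
  have := main_bound a B ha hBpos _ hC ε hε1 φ hφc hφ hφ' h1 h0 n (hN n hn)
  rwa [hna] at this
end

section
/- There exist constants M₁, M₂ > 0 and ε₀ > 0 such that for all 0 < ε < ε₀, (M₂/ln(1/a)) · [ln(1/((1−a)^{1/2} ε))]² ≤ ln C(ε, I_W) ≤ (M₁/ln(1/a)) · [ln(1/((1−a)^{1/2} ε))]², where I_W : H_W → C([−1,1]) is the embedding of the RKHS of the Weierstrass fractal kernel. -/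
open Real Metric

/-- The image under the embedding `I_W` of the unit ball of the RKHS `H_W` of the
Weierstrass fractal kernel, viewed as a subset of `C([−1,1])`: continuous functions
`f(x) = ∑ a^{n/2}[cₙ cos(bⁿπx) + dₙ sin(bⁿπx)]` with `∑(cₙ² + dₙ²) ≤ 1`. -/
def weierstrassUnitBallImage (a : ℝ) (b : ℕ) : Set C(Set.Icc (-1 : ℝ) 1, ℝ) :=
  {f | ∃ c d : ℕ → ℝ,
    Summable (fun n => (c n) ^ 2 + (d n) ^ 2) ∧
    (∑' n : ℕ, ((c n) ^ 2 + (d n) ^ 2)) ≤ 1 ∧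
    ∀ x : Set.Icc (-1 : ℝ) 1,
      f x = ∑' n : ℕ, Real.sqrt a ^ n *
        (c n * Real.cos ((b : ℝ) ^ n * Real.pi * (x : ℝ))
          + d n * Real.sin ((b : ℝ) ^ n * Real.pi * (x : ℝ)))}

/-- Covering number of a set `A` in a (pseudo)metric space: the minimal number of
`ε`-balls covering `A`. -/
noncomputable def coveringNumberSet {Z : Type*} [PseudoMetricSpace Z]
    (ε : ℝ) (A : Set Z) : ℕ∞ :=
  sInf {n : ℕ∞ | ∃ t : Finset Z, (t.card : ℕ∞) = n ∧ A ⊆ ⋃ y ∈ t, Metric.ball y ε}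

theorem coveringNumberSet_le_of_cover {Z : Type*} [PseudoMetricSpace Z] {ε : ℝ} {A : Set Z}
    (t : Finset Z) (h : A ⊆ ⋃ y ∈ t, Metric.ball y ε) :
    coveringNumberSet ε A ≤ (t.card : ℕ∞) :=
  sInf_le ⟨t, rfl, h⟩

theorem card_le_coveringNumberSet {Z : Type*} [PseudoMetricSpace Z] {ε : ℝ} {A : Set Z}
    {ι : Type*} [Fintype ι] (F : ι → Z) (hF : ∀ i, F i ∈ A)
    (hsep : ∀ i j, i ≠ j → 2 * ε ≤ dist (F i) (F j)) :
    (Fintype.card ι : ℕ∞) ≤ coveringNumberSet ε A := by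
  classical
  refine le_sInf ?_
  rintro n ⟨t, rfl, ht⟩
  have h1 : ∀ i, ∃ y ∈ t, dist (F i) y < ε := by
    intro i
    simpa using ht (hF i)
  choose g hg hd using h1
  have hinj : Function.Injective g := by
    intro i j hij
    by_contra hne
    have h2 := hsep i j hne
    have h3 := dist_triangle_right (F i) (F j) (g i)
    have h4 := hd i
    have h5 := hd j
    rw [← hij] at h5
    linarith
  have : Fintype.card ι ≤ t.card := by
    rw [← Finset.card_univ]
    exact Finset.card_le_card_of_injOn g (fun i _ => hg i) hinj.injOn
  exact_mod_cast this

/-- Orthogonality integral. -/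
theorem integral_cos_int (j : ℤ) (hj : j ≠ 0) :
    ∫ x in (-1 : ℝ)..1, Real.cos ((j : ℝ) * Real.pi * x) = 0 := by
  have h : ((j : ℝ) * Real.pi) ≠ 0 := by
    have : (j : ℝ) ≠ 0 := by exact_mod_cast hj
    exact mul_ne_zero this Real.pi_ne_zero
  rw [intervalIntegral.integral_comp_mul_left (fun x => Real.cos x) h, integral_cos]
  have := Real.sin_int_mul_pi j
  simp [this]

theorem integral_cos_mul_cos_pow (b : ℕ) (hb : 2 ≤ b) (n m : ℕ) :
    ∫ x in (-1 : ℝ)..1, Real.cos ((b : ℝ) ^ n * Real.pi * x) *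
      Real.cos ((b : ℝ) ^ m * Real.pi * x) = if n = m then 1 else 0 := by
  have e : ∀ x : ℝ, Real.cos ((b : ℝ) ^ n * Real.pi * x) * Real.cos ((b : ℝ) ^ m * Real.pi * x)
      = (1/2) * (Real.cos ((((b : ℤ) ^ n - (b : ℤ) ^ m : ℤ) : ℝ) * Real.pi * x)
        + Real.cos ((((b : ℤ) ^ n + (b : ℤ) ^ m : ℤ) : ℝ) * Real.pi * x)) := by
    intro x
    push_cast
    rw [sub_mul, sub_mul, add_mul, add_mul, Real.cos_sub, Real.cos_add]
    ring
  simp_rw [e]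
  rw [intervalIntegral.integral_const_mul, intervalIntegral.integral_add
    (Continuous.intervalIntegrable (by fun_prop) _ _)
    (Continuous.intervalIntegrable (by fun_prop) _ _)]
  have hbp : 0 < (b : ℤ) := by omega
  rw [integral_cos_int ((b : ℤ) ^ n + (b : ℤ) ^ m) (by positivity)]
  split_ifs with h
  · subst h
    simp
    norm_num
  · rw [integral_cos_int]
    · simp
    · rw [sub_ne_zero]
      intro h'
      apply h
      have h'' : b ^ n = b ^ m := by exact_mod_cast h'
      exact Nat.pow_right_injective hb h''

/-- The finite cosine/sine polynomials. -/
noncomputable def wPoly (s : ℝ) (b N : ℕ) (c d : ℕ → ℝ) : C(Set.Icc (-1 : ℝ) 1, ℝ) :=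
  ⟨fun x => ∑ n ∈ Finset.range N, s ^ n *
        (c n * Real.cos ((b : ℝ) ^ n * Real.pi * (x : ℝ))
          + d n * Real.sin ((b : ℝ) ^ n * Real.pi * (x : ℝ))), by fun_prop⟩

theorem wPoly_apply (s : ℝ) (b N : ℕ) (c d : ℕ → ℝ) (x : Set.Icc (-1 : ℝ) 1) :
    wPoly s b N c d x = ∑ n ∈ Finset.range N, s ^ n *
        (c n * Real.cos ((b : ℝ) ^ n * Real.pi * (x : ℝ))
          + d n * Real.sin ((b : ℝ) ^ n * Real.pi * (x : ℝ))) := rfl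

theorem coeff_le_dist (s : ℝ) (b N : ℕ) (hb : 2 ≤ b) (c c' : ℕ → ℝ) (m : ℕ) (hm : m < N) :
    |s ^ m * (c m - c' m)| ≤ 2 * dist (wPoly s b N c 0) (wPoly s b N c' 0) := by
  set D := dist (wPoly s b N c 0) (wPoly s b N c' 0) with hD
  set g : ℝ → ℝ := fun x => (∑ n ∈ Finset.range N, (s ^ n * (c n - c' n)) *
    Real.cos ((b : ℝ) ^ n * Real.pi * x)) with hg
  have hgb : ∀ x ∈ Set.Icc (-1 : ℝ) 1, |g x| ≤ D := by
    intro x hx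
    have h1 := ContinuousMap.dist_apply_le_dist (f := wPoly s b N c 0) (g := wPoly s b N c' 0)
      ⟨x, hx⟩
    rw [Real.dist_eq, wPoly_apply, wPoly_apply, ← Finset.sum_sub_distrib] at h1
    refine le_trans (le_of_eq ?_) h1
    congr 1
    refine Finset.sum_congr rfl fun n _ => ?_
    simp
    ring
  have hint : ∫ x in (-1 : ℝ)..1, g x * Real.cos ((b : ℝ) ^ m * Real.pi * x)
      = s ^ m * (c m - c' m) := by
    simp only [hg, Finset.sum_mul]
    rw [intervalIntegral.integral_finsetSum
      (fun i _ => Continuous.intervalIntegrable (by fun_prop) _ _)]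
    simp_rw [mul_assoc (s ^ _ * _) _ _]
    simp_rw [intervalIntegral.integral_const_mul]
    simp_rw [integral_cos_mul_cos_pow b hb]
    simp [hm]
  rw [← hint, ← Real.norm_eq_abs]
  have := intervalIntegral.norm_integral_le_of_norm_le_const (a := (-1 : ℝ)) (b := 1) (C := D)
    (f := fun x => g x * Real.cos ((b : ℝ) ^ m * Real.pi * x)) ?_
  · refine this.trans (le_of_eq ?_)
    norm_num
    ring
  · intro x hx
    rw [Set.uIoc_of_le (by norm_num)] at hx
    have h1 := hgb x ⟨hx.1.le, hx.2⟩
    rw [norm_mul, Real.norm_eq_abs, Real.norm_eq_abs]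
    have h2 := Real.abs_cos_le_one ((b : ℝ) ^ m * Real.pi * x)
    nlinarith [abs_nonneg (g x)]

theorem lower_count (a : ℝ) (b : ℕ) (ha0 : 0 < a) (ha1 : a < 1) (hb : 2 ≤ b)
    (N K : ℕ) (η ε : ℝ) (hη : 0 < η) (h1 : N * (η * K) ^ 2 ≤ 1)
    (h2 : 4 * ε ≤ η * Real.sqrt a ^ N) :
    ((K ^ N : ℕ) : ℕ∞) ≤ coveringNumberSet ε (weierstrassUnitBallImage a b) := by
  set s := Real.sqrt a with hs
  have hs0 : 0 < s := Real.sqrt_pos.2 ha0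
  have hs1 : s < 1 := by
    rw [hs, Real.sqrt_lt' one_pos]; simpa using ha1
  let C : (Fin N → Fin K) → ℕ → ℝ := fun k n => if h : n < N then η * (k ⟨n, h⟩ : ℕ) else 0
  have hC0 : ∀ k n, n ∉ Finset.range N → C k n = 0 := by
    intro k n hn
    simp at hn
    simp [C, hn]
  have hCb : ∀ k n, (C k n) ^ 2 ≤ (η * K) ^ 2 := by
    intro k n
    by_cases h : n < N
    · simp only [C, h, dite_true]
      have : ((k ⟨n, h⟩ : ℕ) : ℝ) ≤ K := by exact_mod_cast (k ⟨n, h⟩).2.le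
      gcongr
    · simp only [C, h, dite_false]
      rw [zero_pow two_ne_zero]
      exact sq_nonneg _
  have key := card_le_coveringNumberSet (ε := ε) (A := weierstrassUnitBallImage a b)
    (fun k : Fin N → Fin K => wPoly s b N (C k) 0) ?_ ?_
  · simpa using key
  · intro k
    refine ⟨C k, 0, ?_, ?_, ?_⟩
    · refine summable_of_ne_finset_zero (s := Finset.range N) ?_
      intro n hn
      simp [hC0 k n hn]
    · rw [tsum_eq_sum (s := Finset.range N) (fun n hn => by simp [hC0 k n hn])]
      refine le_trans (Finset.sum_le_card_nsmul _ _ ((η * K) ^ 2) ?_) ?_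
      · intro n _
        simpa using hCb k n
      · simpa using h1
    · intro x
      rw [tsum_eq_sum (s := Finset.range N) (fun n hn => by simp [hC0 k n hn])]
      rfl
  · intro k k' hne
    obtain ⟨m, hm⟩ := Function.ne_iff.1 hne
    have h3 := coeff_le_dist s b N hb (C k) (C k') m m.2
    have h4 : C k m - C k' m = η * (((k m : ℕ) : ℝ) - ((k' m : ℕ) : ℝ)) := by
      simp [C]; ring
    have h5 : (1 : ℝ) ≤ |((k m : ℕ) : ℝ) - ((k' m : ℕ) : ℝ)| := by
      have : ((k m : ℕ) : ℤ) - ((k' m : ℕ) : ℤ) ≠ 0 := by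
        intro h
        apply hm
        apply Fin.ext
        omega
      have := Int.one_le_abs this
      exact_mod_cast this
    rw [h4, abs_mul, abs_mul, abs_of_pos hη, abs_of_pos (pow_pos hs0 _)] at h3
    have h6 : s ^ N ≤ s ^ (m : ℕ) := pow_le_pow_of_le_one hs0.le hs1.le m.2.le
    have h7 : η * s ^ N ≤ s ^ (m : ℕ) * (η * |((k m : ℕ) : ℝ) - ((k' m : ℕ) : ℝ)|) := by
      calc η * s ^ N ≤ η * s ^ (m : ℕ) := by gcongr
        _ = s ^ (m : ℕ) * (η * 1) := by ring
        _ ≤ _ := by gcongr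
    linarith

theorem trig_term_bound (p q u v B t : ℝ) (ht : 0 ≤ t) (hp : |p| ≤ B) (hq : |q| ≤ B) :
    |t * (p * Real.cos u + q * Real.sin v)| ≤ t * (2 * B) := by
  rw [abs_mul, abs_of_nonneg ht]
  have h1 := Real.abs_cos_le_one u
  have h2 := Real.abs_sin_le_one v
  have h3 : |p * Real.cos u| ≤ B * 1 := by
    rw [abs_mul]
    exact mul_le_mul hp h1 (abs_nonneg _) ((abs_nonneg _).trans hp)
  have h4 : |q * Real.sin v| ≤ B * 1 := by
    rw [abs_mul]
    exact mul_le_mul hq h2 (abs_nonneg _) ((abs_nonneg _).trans hq)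
  have := abs_add_le (p * Real.cos u) (q * Real.sin v)
  gcongr
  linarith

theorem upper_count (a : ℝ) (b : ℕ) (ha0 : 0 < a) (ha1 : a < 1)
    (N K : ℕ) (ε : ℝ) (hε : 0 < ε) (hK0 : 0 < K)
    (h1 : 1 / (K : ℝ) < (1 - Real.sqrt a) * ε / 4)
    (h2 : Real.sqrt a ^ N < (1 - Real.sqrt a) * ε / 4) :
    coveringNumberSet ε (weierstrassUnitBallImage a b) ≤ (((2 * K + 1) ^ (2 * N) : ℕ) : ℕ∞) := by
  classical
  set s := Real.sqrt a with hs
  have hs0 : 0 < s := Real.sqrt_pos.2 ha0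
  have hs1 : s < 1 := by
    rw [hs, Real.sqrt_lt' one_pos]; simpa using ha1
  have hKr : (0 : ℝ) < K := by exact_mod_cast hK0
  let J := Finset.Icc (-(K : ℤ)) K
  let E : (Fin N → J) → ℕ → ℝ := fun k n => if h : n < N then ((k ⟨n, h⟩ : ℤ) : ℝ) / K else 0
  let G : (Fin N → J) × (Fin N → J) → C(Set.Icc (-1 : ℝ) 1, ℝ) :=
    fun p => wPoly s b N (E p.1) (E p.2)
  have hround : ∀ c : ℕ → ℝ, (∀ n, |c n| ≤ 1) → ∃ k : Fin N → J, ∀ n < N,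
      |c n - E k n| ≤ 1 / K := by
    intro c hc
    refine ⟨fun n => ⟨⌊c n * K⌋, ?_⟩, ?_⟩
    · have := abs_le.1 (hc n)
      rw [Finset.mem_Icc]
      constructor
      · rw [Int.le_floor]
        push_cast
        nlinarith
      · have : (⌊c n * K⌋ : ℝ) ≤ ((K : ℤ) : ℝ) := by
          refine (Int.floor_le _).trans ?_
          push_cast
          nlinarith
        exact_mod_cast this
    · intro n hn
      simp only [E, hn, dite_true]
      have e : c n - (⌊c n * K⌋ : ℝ) / K = (c n * K - ⌊c n * K⌋) / K := by
        field_simp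
      rw [e, abs_div, abs_of_pos hKr, abs_of_nonneg (by linarith [Int.floor_le (c n * K)])]
      gcongr
      linarith [Int.lt_floor_add_one (c n * K)]
  have hgeo : HasSum (fun n => s ^ n) (1 - s)⁻¹ := hasSum_geometric_of_lt_one hs0.le hs1
  refine (coveringNumberSet_le_of_cover (Finset.univ.image G) ?_).trans ?_
  · rintro f ⟨c, d, hsum, hle, hf⟩
    have hsq : ∀ n, c n ^ 2 + d n ^ 2 ≤ 1 := fun n =>
      (hsum.le_tsum n (fun j _ => by positivity)).trans hle
    have hc : ∀ n, |c n| ≤ 1 := fun n => by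
      rw [← sq_le_one_iff_abs_le_one]; nlinarith [hsq n, sq_nonneg (d n)]
    have hd : ∀ n, |d n| ≤ 1 := fun n => by
      rw [← sq_le_one_iff_abs_le_one]; nlinarith [hsq n, sq_nonneg (c n)]
    obtain ⟨k, hk⟩ := hround c hc
    obtain ⟨l, hl⟩ := hround d hd
    simp only [Set.mem_iUnion, Finset.mem_image, Finset.mem_univ, true_and]
    refine ⟨G (k, l), ⟨(k, l), rfl⟩, ?_⟩
    rw [Metric.mem_ball, ContinuousMap.dist_lt_iff hε]
    intro x
    rw [hf x, Real.dist_eq]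
    set T : ℕ → ℝ := fun n => s ^ n *
        (c n * Real.cos ((b : ℝ) ^ n * Real.pi * (x : ℝ))
          + d n * Real.sin ((b : ℝ) ^ n * Real.pi * (x : ℝ))) with hT
    have hTb : ∀ n, |T n| ≤ s ^ n * (2 * 1) := fun n =>
      trig_term_bound _ _ _ _ 1 _ (by positivity) (hc n) (hd n)
    have hTs : Summable T :=
      Summable.of_norm_bounded (hgeo.summable.mul_right (2 * 1)) hTb
    rw [← hTs.sum_add_tsum_nat_add N]
    have htail : |∑' n, T (n + N)| ≤ s ^ N * 2 * (1 - s)⁻¹ := by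
      have : HasSum (fun n => s ^ N * 2 * s ^ n) (s ^ N * 2 * (1 - s)⁻¹) := hgeo.mul_left _
      rw [← Real.norm_eq_abs]
      refine tsum_of_norm_bounded this fun n => ?_
      refine (hTb (n + N)).trans (le_of_eq ?_)
      ring
    have hhead : |∑ n ∈ Finset.range N, T n - G (k, l) x| ≤ 2 * (1 / K) * (1 - s)⁻¹ := by
      simp only [G, wPoly_apply]
      rw [← Finset.sum_sub_distrib]
      refine (Finset.abs_sum_le_sum_abs _ _).trans ?_
      have : ∀ n ∈ Finset.range N, |T n - s ^ n *
          (E k n * Real.cos ((b : ℝ) ^ n * Real.pi * (x : ℝ))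
          + E l n * Real.sin ((b : ℝ) ^ n * Real.pi * (x : ℝ)))| ≤ 2 * (1 / K) * s ^ n := by
        intro n hn
        have hn := Finset.mem_range.1 hn
        have := trig_term_bound _ _ ((b : ℝ) ^ n * Real.pi * (x : ℝ))
          ((b : ℝ) ^ n * Real.pi * (x : ℝ)) (1 / K) (s ^ n) (by positivity) (hk n hn) (hl n hn)
        calc _ = _ := by
                congr 1
                simp only [hT]
                ring
          _ ≤ _ := this
          _ = _ := by ring
      refine (Finset.sum_le_sum this).trans ?_
      rw [← Finset.mul_sum]
      gcongr
      exact sum_le_hasSum _ (fun _ _ => by positivity) hgeo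
    have hpos : 0 < 1 - s := by linarith
    have e1 : s ^ N * 2 * (1 - s)⁻¹ < ε / 2 := by
      rw [← div_eq_mul_inv, div_lt_iff₀ hpos]; linarith
    have e2 : 2 * (1 / K) * (1 - s)⁻¹ < ε / 2 := by
      rw [← div_eq_mul_inv, div_lt_iff₀ hpos]; linarith
    have := abs_add_le (∑ n ∈ Finset.range N, T n - G (k, l) x) (∑' n, T (n + N))
    rw [show ∑ n ∈ Finset.range N, T n + ∑' n, T (n + N) - G (k, l) x
      = (∑ n ∈ Finset.range N, T n - G (k, l) x) + ∑' n, T (n + N) by ring]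
    linarith
  · have hcard : (Finset.univ.image G).card ≤ (2 * K + 1) ^ (2 * N) := by
      refine Finset.card_image_le.trans (le_of_eq ?_)
      rw [Finset.card_univ, Fintype.card_prod]
      have hJ : Fintype.card J = 2 * K + 1 := by
        simp only [J, Fintype.card_coe, Int.card_Icc]
        omega
      simp only [Fintype.card_fun, Fintype.card_fin, hJ]
      ring
    exact_mod_cast hcard

/-- Analytic facts valid for all large `ℓ`. -/
theorem eventually_large (q s A : ℝ) (hq : 0 < q) (hs : s < 1) :
    ∃ R : ℝ, 0 < R ∧ ∀ l : ℝ, R < l →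
      A ≤ l ∧ q ≤ l ∧ 8 * q ≤ l ∧ 16 * (l / (4 * q)) ≤ Real.exp l ∧ 2 ≤ Real.exp (l / 8) ∧
      4 / (1 - s) < Real.exp l ∧ 5 ≤ Real.exp l := by
  have h : ∀ᶠ l : ℝ in Filter.atTop,
      (A ≤ l ∧ q ≤ l ∧ 8 * q ≤ l ∧ 16 * (l / (4 * q)) ≤ Real.exp l ∧ 2 ≤ Real.exp (l / 8) ∧
      4 / (1 - s) < Real.exp l ∧ 5 ≤ Real.exp l) := by
    refine (Filter.eventually_ge_atTop _).and <| (Filter.eventually_ge_atTop _).and <|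
      (Filter.eventually_ge_atTop _).and <| Filter.Eventually.and ?_ <| Filter.Eventually.and ?_ <|
      Filter.Eventually.and ?_ ?_
    · have := Real.tendsto_exp_div_pow_atTop 1
      filter_upwards [this.eventually_ge_atTop (4 / q), Filter.eventually_gt_atTop 0] with l h1 h2
      rw [pow_one, le_div_iff₀ h2] at h1
      refine le_trans (le_of_eq ?_) h1
      field_simp
      norm_num
    · filter_upwards [Filter.eventually_ge_atTop 8] with l hl
      linarith [Real.add_one_le_exp (l / 8)]
    · exact Real.tendsto_exp_atTop.eventually_gt_atTop _
    · exact Real.tendsto_exp_atTop.eventually_ge_atTop _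
  obtain ⟨R, hR⟩ := Filter.eventually_atTop.1 h
  exact ⟨max R 1, by positivity, fun l hl => hR l ((le_max_left _ _).trans hl.le)⟩

/-- Sharp estimates for the covering numbers of the embedding
`I_W : H_W → C([−1,1])`: there are constants `M₁, M₂ > 0` and `ε₀ > 0` with
`(M₂/ln(1/a))·[ln(1/((1−a)^{1/2}ε))]² ≤ ln C(ε, I_W) ≤ (M₁/ln(1/a))·[ln(1/((1−a)^{1/2}ε))]²`
for all `0 < ε < ε₀`. -/
theorem weierstrass_covering_number_estimates (a : ℝ) (b : ℕ)
    (ha0 : 0 < a) (ha1 : a < 1) (hb : 2 ≤ b) (hab : 1 ≤ a * b) :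
    ∃ M₁ M₂ ε₀ : ℝ, 0 < M₁ ∧ 0 < M₂ ∧ 0 < ε₀ ∧
      ∀ ε : ℝ, 0 < ε → ε < ε₀ →
        coveringNumberSet ε (weierstrassUnitBallImage a b) ≠ ⊤ ∧
        M₂ / Real.log (1 / a) * (Real.log (1 / (Real.sqrt (1 - a) * ε))) ^ 2
          ≤ Real.log ((coveringNumberSet ε (weierstrassUnitBallImage a b)).toNat) ∧
        Real.log ((coveringNumberSet ε (weierstrassUnitBallImage a b)).toNat)
          ≤ M₁ / Real.log (1 / a) * (Real.log (1 / (Real.sqrt (1 - a) * ε))) ^ 2 := by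
  set s := Real.sqrt a with hs
  have hs0 : 0 < s := Real.sqrt_pos.2 ha0
  have hs1 : s < 1 := by
    rw [hs, Real.sqrt_lt' one_pos]; simpa using ha1
  set q := -Real.log s with hq
  have hqp : 0 < q := by
    have := Real.log_neg hs0 hs1
    linarith
  have hloga : Real.log (1 / a) = 2 * q := by
    rw [one_div, Real.log_inv, hq, hs, Real.log_sqrt ha0.le]; ring
  have hsN : ∀ N : ℕ, s ^ N = Real.exp (-(N * q)) := by
    intro N
    rw [hq, mul_neg, neg_neg, Real.exp_nat_mul, Real.exp_log hs0]
  set w := Real.sqrt (1 - a) with hw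
  have hw0 : 0 < w := Real.sqrt_pos.2 (by linarith)
  have hw1 : w ≤ 1 := by
    rw [hw, Real.sqrt_le_iff]; constructor <;> linarith
  obtain ⟨R, hR0, hR⟩ := eventually_large q s (-Real.log w) hqp hs1
  refine ⟨36, 1 / 128, Real.exp (-R), by norm_num, by norm_num, Real.exp_pos _, ?_⟩
  intro ε hε hεR
  set l := -Real.log ε with hl
  have hεl : ε = Real.exp (-l) := by rw [hl, neg_neg, Real.exp_log hε]
  have hRl : R < l := by
    rw [hεl, Real.exp_lt_exp] at hεR
    linarith
  have hl0 : 0 < l := hR0.trans hRl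
  obtain ⟨g1, g2, g3, g4, g5, g6, g7⟩ := hR l hRl
  have hL : Real.log (1 / (w * ε)) = l - Real.log w := by
    rw [one_div, Real.log_inv, Real.log_mul hw0.ne' hε.ne', hl]; ring
  have hlw : Real.log w ≤ 0 := Real.log_nonpos hw0.le hw1
  rw [hL, hloga]
  have hdiv : 1 < (1 - s) * Real.exp l / 4 := by
    have hpos : 0 < 1 - s := by linarith
    rw [div_lt_iff₀ hpos] at g6
    linarith
  have hε2 : Real.exp (-(2 * l)) < (1 - s) * ε / 4 := by
    have e1 : Real.exp (-(2 * l)) = Real.exp (-(2 * l)) * 1 := by ring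
    have e2 : (1 - s) * ε / 4 = Real.exp (-(2 * l)) * ((1 - s) * Real.exp l / 4) := by
      have : ε = Real.exp (-(2 * l)) * Real.exp l := by
        rw [← Real.exp_add, hεl]; congr 1; ring
      rw [this]; ring
    rw [e1, e2]
    exact mul_lt_mul_of_pos_left hdiv (Real.exp_pos _)
  -- upper
  set N := ⌈2 * l / q⌉₊ with hN
  set K := ⌈Real.exp (2 * l)⌉₊ with hK
  have hKge : Real.exp (2 * l) ≤ K := Nat.le_ceil _
  have hKpos : 0 < K := Nat.ceil_pos.2 (Real.exp_pos _)
  have hup := upper_count a b ha0 ha1 N K ε hε hKpos (by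
      refine lt_of_le_of_lt ?_ hε2
      rw [Real.exp_neg, ← one_div]
      exact one_div_le_one_div_of_le (Real.exp_pos _) hKge) (by
      refine lt_of_le_of_lt ?_ hε2
      rw [← hs, hsN, Real.exp_le_exp, neg_le_neg_iff, ← div_le_iff₀ hqp]
      exact Nat.le_ceil _)
  -- lower
  set N' := ⌊l / (4 * q)⌋₊ with hN'
  set K' := ⌊Real.exp (l / 4)⌋₊ with hK'
  have hN'le : (N' : ℝ) ≤ l / (4 * q) := Nat.floor_le (by positivity)
  have hK'le : (K' : ℝ) ≤ Real.exp (l / 4) := Nat.floor_le (by positivity)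
  have hlow := lower_count a b ha0 ha1 hb N' K' (4 * Real.exp (-(3 * l / 4))) ε (by positivity) (by
      have e0 : 4 * Real.exp (-(3 * l / 4)) * K' ≤ 4 * Real.exp (-(l / 2)) := by
        calc 4 * Real.exp (-(3 * l / 4)) * K'
            ≤ 4 * Real.exp (-(3 * l / 4)) * Real.exp (l / 4) := by gcongr
          _ = 4 * Real.exp (-(l / 2)) := by
            rw [mul_assoc, ← Real.exp_add]; congr 2; ring
      calc (N' : ℝ) * (4 * Real.exp (-(3 * l / 4)) * K') ^ 2
          ≤ (l / (4 * q)) * (4 * Real.exp (-(l / 2))) ^ 2 := by gcongr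
        _ = 16 * (l / (4 * q)) * Real.exp (-l) := by
            rw [mul_pow, ← Real.exp_nat_mul]
            have : ((2 : ℕ) : ℝ) * -(l / 2) = -l := by push_cast; ring
            rw [this]; ring
        _ ≤ Real.exp l * Real.exp (-l) := by gcongr
        _ = 1 := by rw [← Real.exp_add]; simp) (by
      rw [← hs, hsN, mul_assoc, ← Real.exp_add, hεl]
      gcongr
      rw [le_div_iff₀ (by positivity)] at hN'le
      linarith)
  have hne : coveringNumberSet ε (weierstrassUnitBallImage a b) ≠ ⊤ :=
    ne_top_of_le_ne_top (ENat.natCast_ne_top _) hup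
  obtain ⟨n, hn⟩ := ENat.ne_top_iff_exists.1 hne
  refine ⟨hne, ?_, ?_⟩
  · rw [← hn] at hlow ⊢
    rw [ENat.toNat_natCast]
    have hlow' : K' ^ N' ≤ n := by exact_mod_cast hlow
    have k1 : Real.exp (l / 8) ≤ K' := by
      have := Nat.lt_floor_add_one (Real.exp (l / 4))
      rw [← hK'] at this
      have e : Real.exp (l / 4) = Real.exp (l / 8) * Real.exp (l / 8) := by
        rw [← Real.exp_add]; congr 1; ring
      nlinarith
    have k2 : l / (8 * q) ≤ N' := by
      have := Nat.lt_floor_add_one (l / (4 * q))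
      rw [← hN'] at this
      have e : l / (4 * q) = l / (8 * q) + l / (8 * q) := by field_simp; norm_num
      have : 1 ≤ l / (8 * q) := by rw [le_div_iff₀ (by positivity)]; linarith
      linarith
    have hK'pos : (0 : ℝ) < K' := (Real.exp_pos _).trans_le k1
    have k3 : l / 8 ≤ Real.log K' := (Real.le_log_iff_exp_le hK'pos).2 k1
    have k4 : (N' : ℝ) * Real.log K' ≤ Real.log n := by
      rw [← Real.log_pow]
      apply Real.log_le_log (by positivity)
      exact_mod_cast hlow'
    calc 1 / 128 / (2 * q) * (l - Real.log w) ^ 2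
        ≤ 1 / 128 / (2 * q) * (2 * l) ^ 2 := by
          have : 0 ≤ l - Real.log w := by linarith
          gcongr
          linarith
      _ = l / (8 * q) * (l / 8) := by field_simp; norm_num
      _ ≤ N' * Real.log K' := by gcongr
      _ ≤ _ := k4
  · rw [← hn] at hup hlow ⊢
    rw [ENat.toNat_natCast]
    have hup' : n ≤ (2 * K + 1) ^ (2 * N) := by exact_mod_cast hup
    have k1 : (2 * K + 1 : ℝ) ≤ Real.exp (3 * l) := by
      have := Nat.ceil_lt_add_one (Real.exp_pos (2 * l)).le
      rw [← hK] at this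
      have e : Real.exp (3 * l) = Real.exp (2 * l) * Real.exp l := by
        rw [← Real.exp_add]; congr 1; ring
      have : 1 ≤ Real.exp (2 * l) := Real.one_le_exp (by positivity)
      nlinarith
    have k2 : (N : ℝ) ≤ 3 * l / q := by
      have := Nat.ceil_lt_add_one (show 0 ≤ 2 * l / q by positivity)
      rw [← hN] at this
      have e : 3 * l / q = 2 * l / q + l / q := by field_simp; norm_num
      have : 1 ≤ l / q := by rw [le_div_iff₀ (by positivity)]; linarith
      linarith
    have k3 : Real.log (2 * K + 1) ≤ 3 * l := by
      rw [Real.log_le_iff_le_exp (by positivity)]; exact k1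
    have k3' : 0 ≤ Real.log (2 * K + 1) := Real.log_nonneg (by
      have : (0 : ℝ) ≤ K := by positivity
      linarith)
    have k4 : Real.log n ≤ ((2 * N : ℕ) : ℝ) * Real.log (2 * K + 1) := by
      rw [← Real.log_pow]
      rcases Nat.eq_zero_or_pos n with h0 | h0
      · rw [h0]
        simp only [Nat.cast_zero, Real.log_zero]
        rw [Real.log_pow]
        positivity
      · apply Real.log_le_log (by exact_mod_cast h0)
        exact_mod_cast hup'
    calc Real.log n ≤ ((2 * N : ℕ) : ℝ) * Real.log (2 * K + 1) := k4
      _ = 2 * N * Real.log (2 * K + 1) := by push_cast; ring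
      _ ≤ 2 * (3 * l / q) * (3 * l) := by gcongr
      _ = 36 / (2 * q) * l ^ 2 := by field_simp; norm_num
      _ ≤ 36 / (2 * q) * (l - Real.log w) ^ 2 := by
        gcongr
        linarith
end
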